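/- arXiv:1108.2100 — 2 statements merged into one kernel-verified Lean document; each statement's English description precedes it below -/
import Mathlib

section
/- Let H be a group with a finite generating set T, let G₀ be a group with a finite generating set C, let L ≤ H be a subgroup, and let φ : L → G₀ be a homomorphism such that |φ(l)|_C ≤ |l|_T for every l ∈ L. Let K be the HNN extension of H × G₀ with stable letter s, associated subgroups L × Z(G₀) and ψ(L × Z(G₀)), and isomorphism ψ(l, g) = (l, φ(l)·g), i.e. K = ⟨H × G₀, s | s⁻¹(l,g)s = (l, φ(l)g) for all l ∈ L, g ∈ Z(G₀)⟩, with canonical embedding ι : H × G₀ → K. Suppose g ∈ G₀ and there are elements (h₀,g₀), …, (h_{n+1},g_{n+1}) of H × G₀ and signs ε₀, …, ε_n ∈ {±1} such that in K, ι(1, g) = ι(h₀,g₀)·s^{ε₀}·ι(h₁,g₁)·s^{ε₁}⋯ι(h_n,g_n)·s^{ε_n}·ι(h_{n+1},g_{n+1}). Then |g|_C ≤ n·Σ_{i=0}^{n+1} |h_i|_T + Σ_{i=0}^{n+1} |g_i|_C. -/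
/-- The word length of `g` with respect to a generating set `S`: the least `n` such that
`g` is a product of `n` elements of `S ∪ S⁻¹`. -/
noncomputable def wordLength {G : Type*} [Group G] (S : Set G) (g : G) : ℕ :=
  sInf {n | ∃ l : List G, (∀ x ∈ l, x ∈ S ∪ S⁻¹) ∧ l.length = n ∧ l.prod = g}

/-- A minimal word in the generators representing `g`. -/
theorem exists_list_length_eq_wordLength {G : Type*} [Group G] {S : Set G}
    (hS : Subgroup.closure S = ⊤) (g : G) :
    ∃ l : List G, (∀ x ∈ l, x ∈ S ∪ S⁻¹) ∧ l.length = wordLength S g ∧ l.prod = g := by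
  have hne : {n | ∃ l : List G, (∀ x ∈ l, x ∈ S ∪ S⁻¹) ∧ l.length = n ∧ l.prod = g}.Nonempty := by
    obtain ⟨l, hl, hg⟩ := Submonoid.exists_list_of_mem_closure (s := S ∪ S⁻¹) (x := g) (by
      simp [← Subgroup.closure_toSubmonoid, hS])
    exact ⟨l.length, l, hl, rfl, hg⟩
  exact Nat.sInf_mem hne

theorem wordLength_prod_le {G : Type*} [Group G] {S : Set G} {l : List G}
    (hl : ∀ x ∈ l, x ∈ S ∪ S⁻¹) : wordLength S l.prod ≤ l.length :=
  Nat.sInf_le ⟨l, hl, rfl, rfl⟩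

theorem wordLength_mul_le {G : Type*} [Group G] {S : Set G}
    (hS : Subgroup.closure S = ⊤) (x y : G) :
    wordLength S (x * y) ≤ wordLength S x + wordLength S y := by
  obtain ⟨l, hl, hlx, rfl⟩ := exists_list_length_eq_wordLength hS x
  obtain ⟨m, hm, hmy, rfl⟩ := exists_list_length_eq_wordLength hS y
  rw [← hlx, ← hmy, ← List.prod_append, ← List.length_append]
  refine wordLength_prod_le fun z hz => ?_
  exact (List.mem_append.1 hz).elim (hl z) (hm z)

theorem wordLength_inv_le {G : Type*} [Group G] {S : Set G}
    (hS : Subgroup.closure S = ⊤) (x : G) : wordLength S x⁻¹ ≤ wordLength S x := by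
  obtain ⟨l, hl, hlx, rfl⟩ := exists_list_length_eq_wordLength hS x
  rw [← hlx, List.prod_inv_reverse]
  refine (wordLength_prod_le fun z hz => ?_).trans_eq (by simp)
  have hz' : z⁻¹ ∈ l := by simpa using hz
  simpa [or_comm] using hl _ hz'

namespace HNNExtension

variable {G : Type*} [Group G] {A B : Subgroup G} {φ : A ≃* B}

/-- Reducing a word in an HNN extension by `k` pinches, while controlling two weights on the base
group: the stable letter does not increase the weight `a`, and it increases the weight `b` by at
most `a`. -/
theorem exists_reducedWord_weight_le {a b : G → ℕ}
    (ha : ∀ x y, a (x * y) ≤ a x + a y) (hb : ∀ x y, b (x * y) ≤ b x + b y)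
    (hφa : ∀ u (y : toSubgroup A B u), a (toSubgroupEquiv φ u y) ≤ a y)
    (hφb : ∀ u (y : toSubgroup A B u), b (toSubgroupEquiv φ u y) ≤ b y + a y)
    (l : List (ℤˣ × G)) (x : G) :
    ∃ (w : NormalWord.ReducedWord G A B) (k : ℕ),
      w.prod φ = of x * (l.map fun p => t ^ (p.1 : ℤ) * of p.2).prod ∧
      w.toList.length + 2 * k = l.length ∧
      a w.head + (w.toList.map fun p => a p.2).sum ≤ a x + (l.map fun p => a p.2).sum ∧
      b w.head + (w.toList.map fun p => b p.2).sum ≤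
        b x + (l.map fun p => b p.2).sum + k * (a x + (l.map fun p => a p.2).sum) := by
  induction l generalizing x with
  | nil => exact ⟨⟨x, [], List.isChain_nil⟩, 0, by simp [NormalWord.ReducedWord.prod]⟩
  | cons p l ih =>
    obtain ⟨u, y⟩ := p
    obtain ⟨⟨y', l', hl'⟩, k, hprod, hlen, hwa, hwb⟩ := ih y
    simp only [NormalWord.ReducedWord.prod] at hprod hlen hwa hwb
    by_cases hc : y' ∈ toSubgroup A B u ∧ ∃ q ∈ l'.head?, u ≠ q.1
    · obtain ⟨hy', q, hq, hu⟩ := hc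
      obtain ⟨m, rfl⟩ : ∃ m, l' = q :: m := by
        cases l' <;> simp_all
      obtain ⟨v, z⟩ := q
      obtain rfl : v = -u := (Int.units_ne_iff_eq_neg.1 (Ne.symm hu))
      have h1 : _ ≤ a y' := hφa u ⟨y', hy'⟩
      have h2 : _ ≤ b y' + a y' := hφb u ⟨y', hy'⟩
      have hconj : (t ^ (u : ℤ) * of y' * t ^ ((-u : ℤˣ) : ℤ) : HNNExtension G A B φ) =
          of ((toSubgroupEquiv φ u ⟨y', hy'⟩ : toSubgroup A B (-u)) : G) := by
        rcases Int.units_eq_one_or u with rfl | rfl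
        · simp only [Units.val_neg, Units.val_one, zpow_neg, zpow_one]
          exact (equiv_eq_conj (φ := φ) ⟨y', hy'⟩).symm
        · simp only [Units.val_neg, Units.val_one, zpow_neg, zpow_one, inv_inv]
          exact (equiv_symm_eq_conj (φ := φ) ⟨y', hy'⟩).symm
      set c : G := ((toSubgroupEquiv φ u ⟨y', hy'⟩ : toSubgroup A B (-u)) : G)
      refine ⟨⟨x * c * z, m, (List.isChain_cons.1 hl').2⟩, k + 1, ?_, ?_, ?_, ?_⟩
      · simp only [NormalWord.ReducedWord.prod, List.map_cons, List.prod_cons, map_mul, ← hconj]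
        rw [mul_assoc _ (of y), ← hprod]
        simp [mul_assoc]
      · simp at hlen ⊢; omega
      · have := ha (x * c) z
        have := ha x c
        simp at hwa ⊢; omega
      · have := hb (x * c) z
        have := hb x c
        simp only [List.map_cons, List.sum_cons, mul_add, add_mul, one_mul] at hwa hwb ⊢
        omega
    · refine ⟨⟨x, (u, y') :: l', List.isChain_cons.2 ⟨?_, hl'⟩⟩, k, ?_, ?_, ?_, ?_⟩
      · intro q hq hy
        by_contra hu
        exact hc ⟨hy, q, hq, hu⟩
      · simp only [NormalWord.ReducedWord.prod, List.map_cons, List.prod_cons]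
        rw [mul_assoc _ (of y), ← hprod]
        simp [mul_assoc]
      · simp at hlen ⊢; omega
      · simp at hwa ⊢; omega
      · simp only [List.map_cons, List.sum_cons] at hwa hwb ⊢
        nlinarith [Nat.zero_le (k * a x)]

/-- If an element of the base group is the product of a word in an HNN extension, then the number
of stable letters of the word is even, and the word bounds the weight `b` of the element. -/
theorem weight_le_of_of_eq_prod {a b : G → ℕ}
    (ha : ∀ x y, a (x * y) ≤ a x + a y) (hb : ∀ x y, b (x * y) ≤ b x + b y)
    (hφa : ∀ u (y : toSubgroup A B u), a (toSubgroupEquiv φ u y) ≤ a y)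
    (hφb : ∀ u (y : toSubgroup A B u), b (toSubgroupEquiv φ u y) ≤ b y + a y)
    {l : List (ℤˣ × G)} {x g : G}
    (h : (of g : HNNExtension G A B φ) = of x * (l.map fun p => t ^ (p.1 : ℤ) * of p.2).prod) :
    ∃ k, 2 * k = l.length ∧
      b g ≤ b x + (l.map fun p => b p.2).sum + k * (a x + (l.map fun p => a p.2).sum) := by
  obtain ⟨w, k, hprod, hlen, -, hwb⟩ := exists_reducedWord_weight_le ha hb hφa hφb l x
  have hnil := ReducedWord.toList_eq_nil_of_mem_of_range φ w ⟨g, by rw [hprod, h]⟩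
  have hg : w.head = g := of_injective (φ := φ) <| by
    rw [h, ← hprod]
    simp [NormalWord.ReducedWord.prod, hnil]
  exact ⟨k, by simpa [hnil] using hlen, by simpa [hnil, hg] using hwb⟩

end HNNExtension

/-- Moving the first syllable of an alternating product to the front. -/
theorem List.prod_ofFn_mul_eq {M : Type*} [Monoid M] {n : ℕ} (x : Fin (n + 1) → M) (y : Fin n → M) :
    (List.ofFn fun i => x i.castSucc * y i).prod * x (Fin.last n) =
      x 0 * (List.ofFn fun i => y i * x i.succ).prod := by
  induction n with
  | zero => simp
  | succ n ih =>
    have := ih (fun i => x i.succ) (fun i => y i.succ)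
    simp only [List.ofFn_succ, List.prod_cons, mul_assoc, Fin.castSucc_zero]
    simp only [Fin.succ_last, ← Fin.succ_castSucc] at this ⊢
    rw [this]


theorem stmt_8 (H G₀ : Type) [Group H] [Group G₀]
    (T : Finset H) (hT : Subgroup.closure (T : Set H) = ⊤)
    (C : Finset G₀) (hC : Subgroup.closure (C : Set G₀) = ⊤)
    (L : Subgroup H) (φ : L →* G₀)
    (hφ : ∀ l : L, wordLength (C : Set G₀) (φ l) ≤ wordLength (T : Set H) (l : H))
    (Q : Subgroup (H × G₀))
    (ψ : (L.prod (Subgroup.center G₀)) ≃* Q)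
    (hψ : ∀ x : (L.prod (Subgroup.center G₀)),
      ((ψ x : H × G₀)) =
        ((x : H × G₀).1,
          φ ⟨(x : H × G₀).1, (Subgroup.mem_prod.mp x.2).1⟩ * (x : H × G₀).2))
    (g : G₀) (n : ℕ) (h : Fin (n + 2) → H) (gs : Fin (n + 2) → G₀)
    (ε : Fin (n + 1) → ℤ) (hε : ∀ i, ε i = 1 ∨ ε i = -1)
    (heq : (HNNExtension.of (1, g) :
        HNNExtension (H × G₀) (L.prod (Subgroup.center G₀)) Q ψ) =
      (List.ofFn (fun i : Fin (n + 1) =>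
        (HNNExtension.of (h i.castSucc, gs i.castSucc) :
          HNNExtension (H × G₀) (L.prod (Subgroup.center G₀)) Q ψ) *
        HNNExtension.t ^ (ε i))).prod *
      HNNExtension.of (h (Fin.last (n + 1)), gs (Fin.last (n + 1)))) :
    wordLength (C : Set G₀) g ≤
      n * (∑ i : Fin (n + 2), wordLength (T : Set H) (h i)) +
        ∑ i : Fin (n + 2), wordLength (C : Set G₀) (gs i) := by
  set K := HNNExtension (H × G₀) (L.prod (Subgroup.center G₀)) Q ψ
  let a : H × G₀ → ℕ := fun x => wordLength (T : Set H) x.1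
  let b : H × G₀ → ℕ := fun x => wordLength (C : Set G₀) x.2
  have hconj : ∀ u (y : HNNExtension.toSubgroup (L.prod (Subgroup.center G₀)) Q u),
      a (HNNExtension.toSubgroupEquiv ψ u y) ≤ a y ∧
        b (HNNExtension.toSubgroupEquiv ψ u y) ≤ b y + a y := by
    intro u y
    rcases Int.units_eq_one_or u with rfl | rfl
    · change a (ψ y) ≤ a y ∧ b (ψ y) ≤ b y + a y
      rw [hψ y]
      refine ⟨le_rfl, (wordLength_mul_le hC _ _).trans ?_⟩
      rw [add_comm]
      exact Nat.add_le_add_left (hφ _) _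
    · obtain ⟨x, rfl⟩ := ψ.surjective y
      have hx := hψ x
      set l : L := ⟨(x : H × G₀).1, (Subgroup.mem_prod.mp x.2).1⟩
      have ha : a (ψ x) = a x := by simp [a, hx]
      have hb : (x : H × G₀).2 = (φ l)⁻¹ * (ψ x : H × G₀).2 := by simp [hx]
      change a (ψ.symm (ψ x)) ≤ a (ψ x) ∧ b (ψ.symm (ψ x)) ≤ b (ψ x) + a (ψ x)
      rw [MulEquiv.symm_apply_apply, ha]
      refine ⟨le_rfl, ?_⟩
      change wordLength _ (x : H × G₀).2 ≤ _
      rw [hb, add_comm]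
      refine (wordLength_mul_le hC _ _).trans (Nat.add_le_add_right ?_ _)
      exact (wordLength_inv_le hC _).trans (hφ l)
  let v : Fin (n + 1) → ℤˣ := fun i => if ε i = 1 then 1 else -1
  have hv : ∀ i, ((v i : ℤˣ) : ℤ) = ε i := by
    intro i
    rcases hε i with h | h <;> simp [v, h]
  have key := HNNExtension.weight_le_of_of_eq_prod (φ := ψ) (a := a) (b := b)
    (fun _ _ => wordLength_mul_le hT _ _) (fun _ _ => wordLength_mul_le hC _ _)
    (fun u y => (hconj u y).1) (fun u y => (hconj u y).2)
    (l := List.ofFn fun i => (v i, (h i.succ, gs i.succ))) (x := (h 0, gs 0)) (g := (1, g)) <| by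
      rw [heq, List.prod_ofFn_mul_eq
        (fun i => (HNNExtension.of (h i, gs i) : K)) (fun i => HNNExtension.t ^ ε i)]
      simp [List.map_ofFn, Function.comp_def, hv]
  obtain ⟨k, hk, hle⟩ := key
  simp only [List.length_ofFn] at hk
  simp only [a, b, List.map_ofFn, Function.comp_def, List.sum_ofFn] at hle
  rw [← Fin.sum_univ_succ fun i => wordLength (T : Set H) (h i),
    ← Fin.sum_univ_succ fun i => wordLength (C : Set G₀) (gs i), add_comm] at hle
  exact hle.trans (Nat.add_le_add_right (Nat.mul_le_mul_right _ (by omega)) _)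
end

section
/- Let B be a group with trivial center, and let A be a proper subgroup of B. Then the HNN extension U = ⟨B, t | t⁻¹at = a for all a ∈ A⟩ has trivial center. -/
namespace HNNExtension

open NormalWord

variable {G : Type*} [Group G] {A B : Subgroup G} (φ : A ≃* B)

theorem NormalWord.ReducedWord.exists_prod_eq (x : HNNExtension G A B φ) :
    ∃ w : ReducedWord G A B, w.prod φ = x := by
  obtain ⟨d⟩ := TransversalPair.nonempty G A B
  exact ⟨(NormalWord.equiv φ d x).toReducedWord, (NormalWord.equiv φ d).symm_apply_apply x⟩

/-- Multiplying a reduced word on the right by an element of the base group only changes its last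
letter. -/
theorem NormalWord.ReducedWord.exists_prod_eq_mul_of (w : ReducedWord G A B) (hw : w.toList ≠ [])
    (g : G) : ∃ w' : ReducedWord G A B, w'.head = w.head ∧ w'.prod φ = w.prod φ * of g := by
  obtain ⟨h, l, hl⟩ := w
  obtain rfl | ⟨l, a, rfl⟩ := List.eq_nil_or_concat' l
  · exact absurd rfl hw
  · refine ⟨⟨h, l ++ [(a.1, a.2 * g)], ?_⟩, rfl, by simp [ReducedWord.prod, mul_assoc]⟩
    rw [List.isChain_append] at hl ⊢
    exact ⟨hl.1, List.isChain_singleton _, by simpa using hl.2.2⟩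

/-- If the associated subgroups are proper, then the center of an HNN extension is contained in the
base group. -/
theorem center_le_range_of (hA : A ≠ ⊤) (hB : B ≠ ⊤) :
    Subgroup.center (HNNExtension G A B φ) ≤ (of : G →* HNNExtension G A B φ).range := by
  intro z hz
  obtain ⟨w, rfl⟩ := ReducedWord.exists_prod_eq φ z
  by_cases hw : w.toList = []
  · exact ⟨w.head, by simp [ReducedWord.prod, hw]⟩
  exfalso
  obtain ⟨a, l, hal⟩ := List.exists_cons_of_ne_nil hw
  have htop : toSubgroup A B (-a.1) ≠ ⊤ := by
    rcases Int.units_eq_one_or a.1 with h | h <;> simpa [h]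
  refine htop ((Subgroup.eq_top_iff' _).2 fun g => ?_)
  obtain ⟨w', hhead, hprod⟩ := w.exists_prod_eq_mul_of φ hw (w.head * g⁻¹ * w.head⁻¹)
  rw [← Subgroup.mem_center_iff.1 hz] at hprod
  have hcoset := (ReducedWord.map_fst_eq_and_of_prod_eq φ
    (w₁ := ⟨w.head * g⁻¹ * w.head⁻¹ * w.head, w.toList, w.chain⟩) (w₂ := w')
    (by rw [hprod]; simp [ReducedWord.prod, mul_assoc])).2 a.1 (by simp [hal])
  simpa [hhead, mul_assoc] using hcoset

/-- If the associated subgroups are proper and the base group has trivial center, then so does the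
HNN extension. -/
theorem center_eq_bot (hG : Subgroup.center G = ⊥) (hA : A ≠ ⊤) (hB : B ≠ ⊤) :
    Subgroup.center (HNNExtension G A B φ) = ⊥ := by
  refine (Subgroup.eq_bot_iff_forall _).2 fun z hz => ?_
  obtain ⟨g, rfl⟩ := center_le_range_of φ hA hB hz
  have hg : g ∈ Subgroup.center G := Subgroup.mem_center_iff.2 fun h =>
    of_injective (φ := φ) (by simpa using Subgroup.mem_center_iff.1 hz (of h))
  rw [hG, Subgroup.mem_bot] at hg
  rw [hg, map_one]

end HNNExtension

theorem stmt_11 (B : Type) [Group B] (hB : Subgroup.center B = ⊥)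
    (A : Subgroup B) (hA : A ≠ ⊤) :
    Subgroup.center (HNNExtension B A A (MulEquiv.refl A)) = ⊥ :=
  HNNExtension.center_eq_bot _ hB hA hA
end
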